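/- arXiv:2201.10251 — 4 statements merged into one kernel-verified Lean document; each statement's English description precedes it below -/
import Mathlib

section
/- Bohr's inequality: Let f be holomorphic on the open unit disk in ℂ, extending continuously to the closed unit disk, with sup norm ‖f‖∞ = sup{|f(z)| : |z| ≤ 1}, and let f(z) = ∑_{n=0}^∞ a_n z^n be its Taylor expansion about 0. Then for every real r with 0 ≤ r ≤ 1/3, one has ∑_{n=0}^∞ |a_n| r^n ≤ ‖f‖∞. -/
open Real Metric

theorem norm_circleAverage_le {F : ℂ → ℂ} {c : ℂ} {R : ℝ} :
    ‖circleAverage F c R‖ ≤ circleAverage (fun z ↦ ‖F z‖) c R := by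
  have hpi : (0 : ℝ) ≤ 2 * π := by positivity
  rw [circleAverage_def, circleAverage_def, norm_smul, norm_inv, norm_of_nonneg hpi, smul_eq_mul]
  gcongr
  exact intervalIntegral.norm_integral_le_integral_norm hpi

/-- The Taylor coefficients of `f` are its Fourier coefficients on the unit circle. -/
theorem circleAverage_inv_pow_mul {f : ℂ → ℂ} {a : ℕ → ℂ} (hf : DiffContOnCl ℂ f (ball 0 1))
    (hexp : ∀ z ∈ ball (0 : ℂ) 1, HasSum (fun n : ℕ => a n * z ^ n) (f z)) (n : ℕ) :
    circleAverage (fun z ↦ (z⁻¹) ^ n * f z) 0 1 = a n := by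
  have h1 : HasFPowerSeriesAt f (cauchyPowerSeries f 0 1) 0 :=
    (DiffContOnCl.hasFPowerSeriesOnBall (R := 1) (by simpa using hf) one_pos).hasFPowerSeriesAt
  have h2 : HasFPowerSeriesAt f (FormalMultilinearSeries.ofScalars ℂ a) 0 := by
    rw [hasFPowerSeriesAt_iff]
    filter_upwards [ball_mem_nhds (0 : ℂ) one_pos] with z hz
    simpa [FormalMultilinearSeries.coeff_ofScalars, mul_comm] using hexp z hz
  have h3 := congrArg (FormalMultilinearSeries.coeff · n) (h1.eq_formalMultilinearSeries h2)
  simp only [FormalMultilinearSeries.coeff_ofScalars] at h3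
  rw [← h3, FormalMultilinearSeries.coeff, circleAverage_eq_circleIntegral one_ne_zero]
  have h4 := cauchyPowerSeries_apply f 0 1 n 1
  simp only [Pi.one_def] at *
  rw [h4]
  congr 1
  simp only [sub_zero, one_div, smul_eq_mul]
  congr 1
  ext z
  ring

theorem circleAverage_pow_mul {f : ℂ → ℂ} (hf : DiffContOnCl ℂ f (ball 0 1)) {n : ℕ}
    (hn : n ≠ 0) : circleAverage (fun z ↦ z ^ n * f z) 0 1 = 0 := by
  have h : DiffContOnCl ℂ (fun z ↦ z ^ n * f z) (ball 0 |1|) := by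
    rw [abs_one]
    exact (Differentiable.diffContOnCl (by fun_prop : Differentiable ℂ fun z : ℂ ↦ z ^ n)).smul hf
  simpa [hn] using h.circleAverage

/-- The squared norm is a weight on the unit circle with frequencies in `{-n, 0, n}`. -/
theorem ofReal_norm_one_add_sq {c z : ℂ} (hc : ‖c‖ = 1) (hz : ‖z‖ = 1) (n : ℕ) :
    ((‖1 + c * z ^ n‖ ^ 2 : ℝ) : ℂ) =
      2 * (z⁻¹) ^ 0 + c⁻¹ * (z⁻¹) ^ n + c * z ^ n := by
  have hc0 : c ≠ 0 := by rintro rfl; simp at hc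
  have hz0 : z ≠ 0 := by rintro rfl; simp at hz
  rw [Complex.ofReal_pow, ← Complex.mul_conj', map_add, map_one, map_mul, map_pow,
    ← Complex.inv_eq_conj hc, ← Complex.inv_eq_conj hz, inv_pow, inv_pow]
  field_simp
  ring

theorem circleAverage_weight_mul {f : ℂ → ℂ} {a : ℕ → ℂ} (hf : DiffContOnCl ℂ f (ball 0 1))
    (hexp : ∀ z ∈ ball (0 : ℂ) 1, HasSum (fun n : ℕ => a n * z ^ n) (f z))
    {c : ℂ} (hc : ‖c‖ = 1) {n : ℕ} (hn : n ≠ 0) :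
    circleAverage (fun z ↦ ((‖1 + c * z ^ n‖ ^ 2 : ℝ) : ℂ) * f z) 0 1 =
      2 * a 0 + c⁻¹ * a n := by
  have hcont : ContinuousOn f (sphere 0 1) := by
    refine hf.continuousOn.mono ?_
    rw [closure_ball _ one_ne_zero]
    exact sphere_subset_closedBall
  have hz0 : ∀ z ∈ sphere (0 : ℂ) 1, z ≠ 0 := fun z hz ↦ ne_of_mem_sphere hz one_ne_zero
  have hinv (k : ℕ) : CircleIntegrable (fun z ↦ (z⁻¹) ^ k * f z) 0 1 :=
    (((continuousOn_id.inv₀ hz0).pow k).mul hcont).circleIntegrable zero_le_one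
  have hpow : CircleIntegrable (fun z ↦ z ^ n * f z) 0 1 :=
    ((continuousOn_id.pow n).mul hcont).circleIntegrable zero_le_one
  have hcongr : circleAverage (fun z ↦ ((‖1 + c * z ^ n‖ ^ 2 : ℝ) : ℂ) * f z) 0 1 =
      circleAverage (fun z ↦ ((2 : ℂ) • ((z⁻¹) ^ 0 * f z) + c⁻¹ • ((z⁻¹) ^ n * f z)) +
        c • (z ^ n * f z)) 0 1 := by
    refine circleAverage_congr_sphere fun z hz ↦ ?_
    have hz : ‖z‖ = 1 := by simpa using hz
    simp only [ofReal_norm_one_add_sq hc hz n, smul_eq_mul]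
    ring
  have hzero : CircleIntegrable (fun z ↦ (2 : ℂ) • ((z⁻¹) ^ 0 * f z)) 0 1 := (hinv 0).const_smul
  have hneg : CircleIntegrable (fun z ↦ c⁻¹ • ((z⁻¹) ^ n * f z)) 0 1 := (hinv n).const_smul
  have hpos : CircleIntegrable (fun z ↦ c • (z ^ n * f z)) 0 1 := hpow.const_smul
  rw [hcongr, circleAverage_fun_add (CircleIntegrable.fun_add hzero hneg) hpos,
    circleAverage_fun_add hzero hneg,
    circleAverage_fun_smul, circleAverage_fun_smul, circleAverage_fun_smul,
    circleAverage_inv_pow_mul hf hexp, circleAverage_inv_pow_mul hf hexp,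
    circleAverage_pow_mul hf hn]
  simp

theorem circleAverage_weight {c : ℂ} (hc : ‖c‖ = 1) {n : ℕ} (hn : n ≠ 0) :
    circleAverage (fun z ↦ ‖1 + c * z ^ n‖ ^ 2) 0 1 = 2 := by
  have h := circleAverage_weight_mul (f := fun _ ↦ 1) (a := fun k ↦ if k = 0 then 1 else 0)
    diffContOnCl_const (fun z _ ↦ ?_) hc hn
  · have hcomm := Complex.ofRealCLM.circleAverage_comp_comm (c := 0) (R := 1)
      (f := fun z ↦ ‖1 + c * z ^ n‖ ^ 2)
      (Continuous.continuousOn (by fun_prop)).circleIntegrable'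
    simp only [mul_one, hn, if_false, if_true, mul_zero, add_zero] at h
    simp only [Function.comp_def, Complex.ofRealCLM_apply] at hcomm
    rw [h] at hcomm
    exact_mod_cast hcomm.symm
  · convert hasSum_ite_eq 0 (1 : ℂ) using 2 with k
    split_ifs with hk <;> simp [hk]

theorem exists_norm_eq_one_norm_add (a b : ℂ) :
    ∃ c : ℂ, ‖c‖ = 1 ∧ ‖a + c⁻¹ * b‖ = ‖a‖ + ‖b‖ := by
  refine ⟨Complex.exp (((b.arg - a.arg : ℝ) : ℂ) * Complex.I), Complex.norm_exp_ofReal_mul_I _, ?_⟩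
  have h : a + (Complex.exp (((b.arg - a.arg : ℝ) : ℂ) * Complex.I))⁻¹ * b =
      ((‖a‖ + ‖b‖ : ℝ) : ℂ) * Complex.exp (a.arg * Complex.I) := by
    nth_rewrite 1 [← Complex.norm_mul_exp_arg_mul_I a]
    nth_rewrite 2 [← Complex.norm_mul_exp_arg_mul_I b]
    rw [← Complex.exp_neg, mul_left_comm, ← Complex.exp_add]
    push_cast
    ring_nf
  rw [h, norm_mul, Complex.norm_exp_ofReal_mul_I, mul_one, Complex.norm_real,
    norm_of_nonneg (by positivity)]

/-- Carathéodory-type bound on the Taylor coefficients of a bounded function. -/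
theorem two_mul_norm_coeff_zero_add_norm_coeff_le {f : ℂ → ℂ} {a : ℕ → ℂ} {M : ℝ}
    (hf : DiffContOnCl ℂ f (ball 0 1))
    (hexp : ∀ z ∈ ball (0 : ℂ) 1, HasSum (fun n : ℕ => a n * z ^ n) (f z))
    (hM : ∀ z ∈ sphere (0 : ℂ) 1, ‖f z‖ ≤ M) {n : ℕ} (hn : n ≠ 0) :
    2 * ‖a 0‖ + ‖a n‖ ≤ 2 * M := by
  obtain ⟨c, hc, hsum⟩ := exists_norm_eq_one_norm_add (2 * a 0) (a n)
  rw [norm_mul, Complex.norm_ofNat] at hsum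
  have hcont : ContinuousOn f (sphere 0 1) := by
    refine hf.continuousOn.mono ?_
    rw [closure_ball _ one_ne_zero]
    exact sphere_subset_closedBall
  rw [← hsum, ← circleAverage_weight_mul hf hexp hc hn]
  calc _ ≤ circleAverage (fun z ↦ ‖((‖1 + c * z ^ n‖ ^ 2 : ℝ) : ℂ) * f z‖) 0 1 :=
        norm_circleAverage_le
    _ ≤ circleAverage (fun z ↦ M • ‖1 + c * z ^ n‖ ^ 2) 0 1 := by
        refine circleAverage_mono ?_ ?_ fun z hz ↦ ?_
        · refine ContinuousOn.circleIntegrable zero_le_one (ContinuousOn.norm (.mul ?_ hcont))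
          exact Continuous.continuousOn (by fun_prop)
        · exact (Continuous.continuousOn (by fun_prop)).circleIntegrable'
        · rw [norm_mul, Complex.norm_real, norm_of_nonneg (by positivity), mul_comm, smul_eq_mul]
          gcongr
          exact hM z (by simpa using hz)
    _ = 2 * M := by
        rw [circleAverage_fun_smul, circleAverage_weight hc hn, smul_eq_mul, mul_comm]

/-- **Bohr's inequality.** If `f` is holomorphic on the open unit disk, extends
continuously to the closed unit disk, and has Taylor expansion
`f z = ∑ aₙ zⁿ` there, then for every `0 ≤ r ≤ 1/3` the majorant series
`∑ |aₙ| rⁿ` converges and is bounded by the sup norm of `f` on the closed disk. -/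
theorem bohr_inequality (f : ℂ → ℂ) (a : ℕ → ℂ)
    (hdiff : DifferentiableOn ℂ f (Metric.ball (0 : ℂ) 1))
    (hcont : ContinuousOn f (Metric.closedBall (0 : ℂ) 1))
    (hexp : ∀ z ∈ Metric.ball (0 : ℂ) 1, HasSum (fun n : ℕ => a n * z ^ n) (f z))
    (r : ℝ) (hr0 : 0 ≤ r) (hr : r ≤ 1 / 3) :
    Summable (fun n : ℕ => ‖a n‖ * r ^ n) ∧
      ∑' n : ℕ, ‖a n‖ * r ^ n ≤
        sSup ((fun z : ℂ => ‖f z‖) '' Metric.closedBall (0 : ℂ) 1) := by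
  set M := sSup ((fun z : ℂ => ‖f z‖) '' closedBall (0 : ℂ) 1)
  have hM : ∀ z ∈ sphere (0 : ℂ) 1, ‖f z‖ ≤ M := fun z hz ↦
    le_csSup ((isCompact_closedBall 0 1).image_of_continuousOn hcont.norm).bddAbove
      (Set.mem_image_of_mem _ (sphere_subset_closedBall hz))
  have hf : DiffContOnCl ℂ f (ball 0 1) := ⟨hdiff, by rwa [closure_ball _ one_ne_zero]⟩
  have hgeom : HasSum (fun n : ℕ ↦ 2 * (M - ‖a 0‖) * (1 / 3) * (1 / 3 : ℝ) ^ n) (M - ‖a 0‖) := by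
    have h := (hasSum_geometric_of_lt_one (r := (1 / 3 : ℝ)) (by norm_num)
      (by norm_num)).mul_left (2 * (M - ‖a 0‖) * (1 / 3))
    rwa [show 2 * (M - ‖a 0‖) * (1 / 3) * (1 - 1 / 3 : ℝ)⁻¹ = M - ‖a 0‖ by norm_num; ring] at h
  have hle (n : ℕ) : ‖a (n + 1)‖ * r ^ (n + 1) ≤ 2 * (M - ‖a 0‖) * (1 / 3) * (1 / 3 : ℝ) ^ n := by
    have h := two_mul_norm_coeff_zero_add_norm_coeff_le hf hexp hM n.succ_ne_zero
    calc ‖a (n + 1)‖ * r ^ (n + 1) ≤ ‖a (n + 1)‖ * (1 / 3) ^ (n + 1) := by gcongr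
      _ ≤ 2 * (M - ‖a 0‖) * (1 / 3) ^ (n + 1) := by gcongr; linarith
      _ = _ := by ring
  have htail : Summable fun n : ℕ ↦ ‖a (n + 1)‖ * r ^ (n + 1) :=
    hgeom.summable.of_nonneg_of_le (fun n ↦ by positivity) hle
  have hsum : Summable fun n : ℕ ↦ ‖a n‖ * r ^ n := (summable_nat_add_iff 1).1 htail
  refine ⟨hsum, ?_⟩
  rw [hsum.tsum_eq_zero_add, pow_zero, mul_one]
  linarith [hasSum_le hle htail.hasSum hgeom]
end

section
/- Sharpness of Bohr's radius: for every real r with 1/3 < r < 1, there exists a function f in the disk algebra with ‖f‖∞ = 1 whose Taylor coefficients a_n about 0 satisfy ∑_{n=0}^∞ |a_n| r^n > 1. In fact one may take f = φ_a for a suitable a with |a| < 1, where φ_a(z) = (z - a)/(1 - conj(a) z). -/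
/-- The modulus of a Blaschke factor with real parameter `a ∈ (-1, 1)` is at most `1` on the closed
unit disk. -/
theorem norm_blaschke_le_one {a : ℝ} (ha : |a| < 1) {z : ℂ} (hz : ‖z‖ ≤ 1) :
    ‖(z - a) / (1 - (a : ℂ) * z)‖ ≤ 1 := by
  rw [norm_div]
  refine div_le_one_of_le₀ ?_ (norm_nonneg _)
  rw [← sq_le_sq₀ (norm_nonneg _) (norm_nonneg _), ← Complex.normSq_eq_norm_sq,
    ← Complex.normSq_eq_norm_sq]
  have hz2 : Complex.normSq z ≤ 1 := by
    rw [Complex.normSq_eq_norm_sq]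
    exact pow_le_one₀ (norm_nonneg _) hz
  have ha2 : a ^ 2 < 1 := (sq_lt_one_iff_abs_lt_one a).mpr ha
  simp only [Complex.normSq_apply, Complex.sub_re, Complex.sub_im, Complex.mul_re, Complex.mul_im,
    Complex.ofReal_re, Complex.ofReal_im, Complex.one_re, Complex.one_im] at hz2 ⊢
  nlinarith [mul_nonneg (sub_nonneg.mpr hz2) (sub_nonneg.mpr ha2.le)]

/-- The Taylor coefficients about `0` of the Blaschke factor with real parameter `a`. -/
def blaschkeCoeff (a : ℝ) : ℕ → ℂ
  | 0 => -a
  | n + 1 => (1 - a ^ 2) * a ^ n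

/-- The Taylor expansion of a Blaschke factor with real parameter. -/
theorem hasSum_blaschkeCoeff {a : ℝ} {z : ℂ} (h : ‖(a : ℂ) * z‖ < 1) :
    HasSum (fun n : ℕ => blaschkeCoeff a n * z ^ n) ((z - a) / (1 - (a : ℂ) * z)) := by
  have hne : 1 - (a : ℂ) * z ≠ 0 := by
    intro h0
    rw [← sub_eq_zero.mp h0, norm_one] at h
    exact lt_irrefl _ h
  have hval : (z - a) / (1 - (a : ℂ) * z) - ∑ i ∈ Finset.range 1, blaschkeCoeff a i * z ^ i =
      (1 - (a : ℂ) ^ 2) * z * (1 - (a : ℂ) * z)⁻¹ := by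
    simp only [Finset.sum_range_one, blaschkeCoeff]
    rw [← div_eq_mul_inv, sub_eq_iff_eq_add, div_add' _ _ _ hne]
    congr 1
    ring
  rw [← hasSum_nat_add_iff' 1, hval]
  refine ((hasSum_geometric_of_norm_lt_one h).mul_left ((1 - (a : ℂ) ^ 2) * z)).congr_fun fun n => ?_
  simp only [blaschkeCoeff]
  ring

/-- The majorant series of a Blaschke factor with parameter `a ∈ [0, 1]`. -/
theorem hasSum_norm_blaschkeCoeff {a r : ℝ} (ha : 0 ≤ a) (ha1 : a ≤ 1) (hr : 0 ≤ r)
    (h : a * r < 1) :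
    HasSum (fun n : ℕ => ‖blaschkeCoeff a n‖ * r ^ n) (a + (1 - a ^ 2) * r / (1 - a * r)) := by
  have hval : a + (1 - a ^ 2) * r / (1 - a * r) -
      ∑ i ∈ Finset.range 1, ‖blaschkeCoeff a i‖ * r ^ i = (1 - a ^ 2) * r * (1 - a * r)⁻¹ := by
    simp [blaschkeCoeff, abs_of_nonneg ha, div_eq_mul_inv]
  rw [← hasSum_nat_add_iff' 1, hval]
  refine ((hasSum_geometric_of_lt_one (mul_nonneg ha hr) h).mul_left
    ((1 - a ^ 2) * r)).congr_fun fun n => ?_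
  have hcoeff : blaschkeCoeff a (n + 1) = (((1 - a ^ 2) * a ^ n : ℝ) : ℂ) := by
    push_cast [blaschkeCoeff]
    rfl
  rw [hcoeff, Complex.norm_of_nonneg
    (mul_nonneg (sub_nonneg.mpr (pow_le_one₀ ha ha1)) (pow_nonneg ha n))]
  ring

/-- **Sharpness of the Bohr radius `1/3`.** For every `1/3 < r < 1` there is a
Blaschke factor `φ_a(z) = (z - a)/(1 - conj a * z)` with `|a| < 1`, which lies
in the disk algebra and has sup norm `1`, whose Taylor coefficients `c n`
satisfy `∑ |c n| rⁿ > 1`. -/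
theorem bohr_radius_sharp (r : ℝ) (hr13 : 1 / 3 < r) (hr1 : r < 1) :
    ∃ a : ℂ, ‖a‖ < 1 ∧
      sSup ((fun z : ℂ => ‖(z - a) / (1 - (starRingEnd ℂ) a * z)‖) ''
          Metric.closedBall (0 : ℂ) 1) = 1 ∧
      ∃ c : ℕ → ℂ,
        (∀ z ∈ Metric.ball (0 : ℂ) 1,
          HasSum (fun n : ℕ => c n * z ^ n) ((z - a) / (1 - (starRingEnd ℂ) a * z))) ∧
        1 < ∑' n : ℕ, ‖c n‖ * r ^ n := by
  have hr0 : 0 < r := by linarith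
  obtain ⟨a, har⟩ : ∃ a : ℝ, a * r = (1 + r) / 4 := ⟨(1 + r) / 4 / r, by field_simp⟩
  have ha0 : 0 < a := pos_of_mul_pos_left (by rw [har]; linarith) hr0.le
  have ha1 : a < 1 := by nlinarith
  have habs : |a| < 1 := by rwa [abs_of_pos ha0]
  have hnorm : ‖(a : ℂ)‖ < 1 := by simpa using habs
  refine ⟨a, hnorm, ?_, blaschkeCoeff a, ?_, ?_⟩
  · simp only [Complex.conj_ofReal]
    refine IsGreatest.csSup_eq ⟨⟨1, by simp, ?_⟩, ?_⟩
    · have hne : (1 : ℂ) - a ≠ 0 := sub_ne_zero.mpr (by exact_mod_cast ha1.ne')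
      simp [div_self hne]
    · rintro _ ⟨z, hz, rfl⟩
      exact norm_blaschke_le_one habs (mem_closedBall_zero_iff.mp hz)
  · intro z hz
    rw [Complex.conj_ofReal]
    refine hasSum_blaschkeCoeff ?_
    rw [norm_mul]
    exact mul_lt_one_of_nonneg_of_lt_one_left (norm_nonneg _) hnorm
      (mem_ball_zero_iff.mp hz).le
  · have har1 : a * r < 1 := by linarith
    rw [(hasSum_norm_blaschkeCoeff ha0.le ha1.le hr0.le har1).tsum_eq, ← sub_lt_iff_lt_add',
      lt_div_iff₀ (by linarith)]
    nlinarith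
end

section
/- Bohr's inequality for finite Blaschke products: let B(z) = ∏_{k=1}^n (z - z_k)/(1 - conj(z_k) z) with |z_k| < 1 for each k, and let (a_m) be the Taylor coefficients of B about 0. Then for every real r with 0 ≤ r ≤ 1/3, ∑_{m=0}^∞ |a_m| r^m ≤ 1. -/
open Metric Filter Topology

/-- A power series that converges on the open unit disc is a power series expansion there. -/
theorem hasFPowerSeriesOnBall_ofScalars_of_hasSum {f : ℂ → ℂ} {b : ℕ → ℂ}
    (hf : ∀ z ∈ ball (0 : ℂ) 1, HasSum (fun m : ℕ => b m * z ^ m) (f z)) :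
    HasFPowerSeriesOnBall f (FormalMultilinearSeries.ofScalars ℂ b) 0 1 where
  r_le := by
    refine ENNReal.le_of_forall_nnreal_lt fun r hr => ?_
    have hr1 : (r : ℝ) < 1 := by exact_mod_cast hr
    refine FormalMultilinearSeries.le_radius_of_tendsto (l := 0) _ ?_
    have h := (hf (r : ℝ) (by simpa using hr1)).summable.tendsto_atTop_zero.norm
    simpa [FormalMultilinearSeries.ofScalars_norm] using h
  r_pos := one_pos
  hasSum := fun {z} hz => by
    have hz1 : z ∈ ball (0 : ℂ) 1 := by simpa [enorm_eq_nnnorm, ← NNReal.coe_lt_coe] using hz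
    simpa [FormalMultilinearSeries.ofScalars_apply_eq, mul_comm] using hf z hz1

/-- **Cauchy's formula** for Taylor coefficients as a circle average. -/
theorem circleAverage_mul_inv_pow_eq_coeff {f : ℂ → ℂ} {b : ℕ → ℂ}
    (hf : ∀ z ∈ ball (0 : ℂ) 1, HasSum (fun m : ℕ => b m * z ^ m) (f z))
    {ρ : ℝ} (hρ0 : 0 < ρ) (hρ1 : ρ < 1) (m : ℕ) :
    Real.circleAverage (fun z => f z * (z ^ m)⁻¹) 0 ρ = b m := by
  have hp := hasFPowerSeriesOnBall_ofScalars_of_hasSum hf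
  lift ρ to NNReal using hρ0.le
  have hd : DifferentiableOn ℂ f (closedBall 0 ρ) := by
    refine hp.differentiableOn.mono fun z hz => ?_
    have : ‖z‖ < 1 := (mem_closedBall_zero_iff.1 hz).trans_lt hρ1
    simpa [enorm_eq_nnnorm, ← NNReal.coe_lt_coe] using this
  have hq := hd.hasFPowerSeriesOnBall (by exact_mod_cast hρ0)
  have h := congrArg (fun p : FormalMultilinearSeries ℂ ℂ ℂ => p m fun _ => 1)
    (hq.hasFPowerSeriesAt.eq_formalMultilinearSeries hp.hasFPowerSeriesAt)
  simp only [cauchyPowerSeries_apply, FormalMultilinearSeries.ofScalars_apply_eq] at h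
  rw [Real.circleAverage_eq_circleIntegral hρ0.ne']
  simpa [mul_comm, mul_left_comm, mul_assoc] using h

/-- **Carathéodory's inequality**: a power series with nonnegative real part on the unit disc has
coefficients bounded by twice the real part of its constant coefficient. -/
theorem norm_coeff_le_two_mul_re_of_re_nonneg {f : ℂ → ℂ} {b : ℕ → ℂ}
    (hf : ∀ z ∈ ball (0 : ℂ) 1, HasSum (fun m : ℕ => b m * z ^ m) (f z))
    (hre : ∀ z ∈ ball (0 : ℂ) 1, 0 ≤ (f z).re) {m : ℕ} (hm : m ≠ 0) :
    ‖b m‖ ≤ 2 * (b 0).re := by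
  have key : ∀ ρ ∈ Set.Ioo (0 : ℝ) 1, ‖b m‖ * ρ ^ m ≤ 2 * (b 0).re := by
    rintro ρ ⟨hρ0, hρ1⟩
    obtain ⟨c, hc, hcb⟩ := Complex.exists_norm_eq_mul_self (b m)
    have hdiff : DifferentiableOn ℂ f (closedBall 0 ρ) := by
      refine (hasFPowerSeriesOnBall_ofScalars_of_hasSum hf).differentiableOn.mono fun z hz => ?_
      have : ‖z‖ < 1 := (mem_closedBall_zero_iff.1 hz).trans_lt hρ1
      simpa [enorm_eq_nnnorm, ← NNReal.coe_lt_coe] using this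
    set s : ℂ := -c * (ρ : ℂ) ^ m with hs
    have hsn : ‖s‖ = ρ ^ m := by simp [hs, hc, abs_of_pos hρ0]
    have hcont : ContinuousOn f (sphere 0 ρ) :=
      hdiff.continuousOn.mono sphere_subset_closedBall
    have hinv : ContinuousOn (fun z : ℂ => (z ^ m)⁻¹) (sphere 0 ρ) :=
      (continuousOn_id.pow m).inv₀ fun z hz =>
        pow_ne_zero _ (ne_zero_of_mem_sphere hρ0.ne' ⟨z, hz⟩)
    have i₀ : CircleIntegrable (fun z => (2 : ℂ) • f z) 0 ρ :=
      (hcont.const_smul (2 : ℂ)).circleIntegrable hρ0.le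
    have i₁ : CircleIntegrable (fun z => s⁻¹ • (f z * z ^ m)) 0 ρ :=
      ((hcont.mul (continuousOn_id.pow m)).const_smul s⁻¹).circleIntegrable hρ0.le
    have i₂ : CircleIntegrable (fun z => s • (f z * (z ^ m)⁻¹)) 0 ρ :=
      ((hcont.mul hinv).const_smul s).circleIntegrable hρ0.le
    have i₀₁ : CircleIntegrable (fun z => (2 : ℂ) • f z + s⁻¹ • (f z * z ^ m)) 0 ρ := i₀.add i₁
    have i : CircleIntegrable
        (fun z => (2 : ℂ) • f z + s⁻¹ • (f z * z ^ m) + s • (f z * (z ^ m)⁻¹)) 0 ρ := i₀₁.add i₂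
    have a₀ : Real.circleAverage f 0 ρ = b 0 := by
      simpa using circleAverage_mul_inv_pow_eq_coeff hf hρ0 hρ1 0
    have a₁ : Real.circleAverage (fun z => f z * z ^ m) 0 ρ = 0 := by
      have hd : DiffContOnCl ℂ (fun z => f z * z ^ m) (ball 0 |ρ|) := by
        rw [abs_of_pos hρ0]
        exact ((hdiff.mul (differentiableOn_id.pow m)).mono
          closure_ball_subset_closedBall).diffContOnCl
      simpa [hm] using hd.circleAverage
    have a₂ := circleAverage_mul_inv_pow_eq_coeff hf hρ0 hρ1 m
    have havg : Real.circleAverage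
        (fun z => (2 : ℂ) • f z + s⁻¹ • (f z * z ^ m) + s • (f z * (z ^ m)⁻¹)) 0 ρ
          = 2 * b 0 + s * b m := by
      rw [Real.circleAverage_fun_add i₀₁ i₂, Real.circleAverage_fun_add i₀ i₁,
        Real.circleAverage_fun_smul, Real.circleAverage_fun_smul, Real.circleAverage_fun_smul,
        a₀, a₁, a₂]
      simp
    have hnonneg : 0 ≤ (2 * b 0 + s * b m).re := by
      rw [← havg, ← Complex.reCLM_apply, ← Complex.reCLM.circleAverage_comp_comm i]
      refine Real.circleAverage_nonneg_of_nonneg fun z hz => ?_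
      rw [abs_of_pos hρ0, mem_sphere_zero_iff_norm] at hz
      have hq : ‖s⁻¹ * z ^ m‖ = 1 := by
        rw [norm_mul, norm_inv, hsn, norm_pow, hz]
        exact inv_mul_cancel₀ (by positivity)
      have hqinv : s * (z ^ m)⁻¹ = starRingEnd ℂ (s⁻¹ * z ^ m) := by
        rw [← Complex.inv_eq_conj hq, mul_inv, inv_inv]
      have hkernel : (2 : ℂ) • f z + s⁻¹ • (f z * z ^ m) + s • (f z * (z ^ m)⁻¹)
          = ((2 + 2 * (s⁻¹ * z ^ m).re : ℝ) : ℂ) * f z := by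
        have := Complex.add_conj (s⁻¹ * z ^ m)
        push_cast at this ⊢
        simp only [smul_eq_mul]
        linear_combination f z * this + f z * hqinv
      have hq1 : -1 ≤ (s⁻¹ * z ^ m).re := by
        have := (abs_le.1 (Complex.abs_re_le_norm (s⁻¹ * z ^ m))).1
        rwa [hq] at this
      simp only [Function.comp_apply, Complex.reCLM_apply]
      rw [hkernel, Complex.re_ofReal_mul]
      exact mul_nonneg (by linarith) (hre z (by simpa [hz] using hρ1))
    have hsb : s * b m = ((-(‖b m‖ * ρ ^ m) : ℝ) : ℂ) := by
      push_cast
      rw [hcb, hs]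
      ring
    rw [hsb, Complex.add_re, Complex.ofReal_re] at hnonneg
    simp only [Complex.mul_re, Complex.re_ofNat, Complex.im_ofNat, zero_mul, sub_zero] at hnonneg
    linarith
  have hlim : Tendsto (fun ρ : ℝ => ‖b m‖ * ρ ^ m) (𝓝[<] 1) (𝓝 (‖b m‖ * 1 ^ m)) :=
    ((continuous_const.mul (continuous_pow m)).tendsto 1).mono_left nhdsWithin_le_nhds
  have := le_of_tendsto hlim (eventually_of_mem (Ioo_mem_nhdsLT one_pos) key)
  simpa using this

/-- The positive-index coefficients of a power series bounded by `1` on the unit disc. -/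
theorem norm_coeff_le_two_mul_one_sub_of_norm_le_one {f : ℂ → ℂ} {a : ℕ → ℂ}
    (hf : ∀ z ∈ ball (0 : ℂ) 1, HasSum (fun m : ℕ => a m * z ^ m) (f z))
    (hbound : ∀ z ∈ ball (0 : ℂ) 1, ‖f z‖ ≤ 1) {m : ℕ} (hm : m ≠ 0) :
    ‖a m‖ ≤ 2 * (1 - ‖a 0‖) := by
  obtain ⟨c, hc, hca⟩ := Complex.exists_norm_eq_mul_self (a 0)
  have hsum : ∀ z ∈ ball (0 : ℂ) 1,
      HasSum (fun k : ℕ => ((if k = 0 then 1 else 0) - c * a k) * z ^ k) (1 - c * f z) := by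
    intro z hz
    have h1 : HasSum (fun k : ℕ => if k = 0 then (1 : ℂ) else 0) 1 := hasSum_ite_eq 0 1
    refine (h1.sub ((hf z hz).mul_left c)).congr_fun fun k => ?_
    split_ifs with hk
    · simp [hk]
    · ring
  have h := norm_coeff_le_two_mul_re_of_re_nonneg hsum (fun z hz => ?_) hm
  · simpa [hm, hc, ← hca] using h
  · have : (c * f z).re ≤ 1 := (Complex.re_le_norm _).trans (by simpa [hc] using hbound z hz)
    simpa using this

/-- **Bohr's inequality** for power series bounded by `1` on the unit disc. -/
theorem tsum_norm_coeff_mul_pow_le_one {f : ℂ → ℂ} {a : ℕ → ℂ}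
    (hf : ∀ z ∈ ball (0 : ℂ) 1, HasSum (fun m : ℕ => a m * z ^ m) (f z))
    (hbound : ∀ z ∈ ball (0 : ℂ) 1, ‖f z‖ ≤ 1)
    {r : ℝ} (hr0 : 0 ≤ r) (hr : r ≤ 1 / 3) :
    ∑' m : ℕ, ‖a m‖ * r ^ m ≤ 1 := by
  have hcoeff : ∀ m : ℕ, ‖a (m + 1)‖ ≤ 2 * (1 - ‖a 0‖) := fun m =>
    norm_coeff_le_two_mul_one_sub_of_norm_le_one hf hbound m.succ_ne_zero
  have hA : 0 ≤ 2 * (1 - ‖a 0‖) := (norm_nonneg _).trans (hcoeff 0)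
  have hterm : ∀ m : ℕ, ‖a (m + 1)‖ * r ^ (m + 1) ≤ 2 * (1 - ‖a 0‖) * (1 / 3) * (1 / 3) ^ m := by
    intro m
    calc ‖a (m + 1)‖ * r ^ (m + 1) ≤ 2 * (1 - ‖a 0‖) * (1 / 3) ^ (m + 1) := by
          gcongr
          exact hcoeff m
      _ = _ := by ring
  have hgeom := (hasSum_geometric_of_lt_one (r := (1 / 3 : ℝ)) (by norm_num)
    (by norm_num)).mul_left (2 * (1 - ‖a 0‖) * (1 / 3))
  have hs : Summable fun m : ℕ => ‖a (m + 1)‖ * r ^ (m + 1) :=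
    Summable.of_nonneg_of_le (fun m => by positivity) hterm hgeom.summable
  have htail := hasSum_le hterm hs.hasSum hgeom
  have hsum : Summable fun m : ℕ => ‖a m‖ * r ^ m :=
    (summable_nat_add_iff (f := fun m : ℕ => ‖a m‖ * r ^ m) 1).1 hs
  rw [hsum.tsum_eq_zero_add, pow_zero, mul_one]
  have hinv : (1 - 1 / 3 : ℝ)⁻¹ = 3 / 2 := by norm_num
  rw [hinv] at htail
  linarith

/-- A Blaschke factor is bounded by `1` on the unit disc. -/
theorem norm_sub_div_one_sub_conj_mul_le_one {w z : ℂ} (hw : ‖w‖ ≤ 1) (hz : ‖z‖ ≤ 1) :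
    ‖(z - w) / (1 - starRingEnd ℂ w * z)‖ ≤ 1 := by
  rw [norm_div]
  refine div_le_one_of_le₀ ?_ (norm_nonneg _)
  rw [← sq_le_sq₀ (norm_nonneg _) (norm_nonneg _)]
  have h : ‖1 - starRingEnd ℂ w * z‖ ^ 2 - ‖z - w‖ ^ 2 = (1 - ‖w‖ ^ 2) * (1 - ‖z‖ ^ 2) := by
    simp only [Complex.sq_norm, Complex.normSq_apply, Complex.sub_re, Complex.sub_im,
      Complex.mul_re, Complex.mul_im, Complex.conj_re, Complex.conj_im, Complex.one_re,
      Complex.one_im]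
    ring
  have := mul_nonneg (sub_nonneg.2 (pow_le_one₀ (n := 2) (norm_nonneg w) hw))
    (sub_nonneg.2 (pow_le_one₀ (n := 2) (norm_nonneg z) hz))
  linarith

/-- **Bohr's inequality for finite Blaschke products.** If
`B(z) = ∏_{k=1}^n (z - z_k)/(1 - conj z_k * z)` with every `|z_k| < 1`, and
`(aₘ)` are the Taylor coefficients of `B` about `0`, then for every
`0 ≤ r ≤ 1/3`, `∑ |aₘ| rᵐ ≤ 1`. -/
theorem bohr_finite_blaschke_product (n : ℕ) (w : Fin n → ℂ)
    (hw : ∀ k, ‖w k‖ < 1) (a : ℕ → ℂ)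
    (ha : ∀ z ∈ Metric.ball (0 : ℂ) 1,
      HasSum (fun m : ℕ => a m * z ^ m)
        (∏ k : Fin n, (z - w k) / (1 - (starRingEnd ℂ) (w k) * z)))
    (r : ℝ) (hr0 : 0 ≤ r) (hr : r ≤ 1 / 3) :
    ∑' m : ℕ, ‖a m‖ * r ^ m ≤ 1 := by
  refine tsum_norm_coeff_mul_pow_le_one ha (fun z hz => ?_) hr0 hr
  rw [norm_prod]
  exact Finset.prod_le_one (fun _ _ => norm_nonneg _) fun k _ =>
    norm_sub_div_one_sub_conj_mul_le_one (hw k).le (mem_ball_zero_iff.1 hz).le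
end

section
/- Failure of the Blaschke-factor bound beyond radius 1/3: for every real r with 1/3 < r < 1, there exists a real t with 0 < t < 1 such that (t + (1 - 2t²) r)/(1 - t r) > 1; equivalently, the function t ↦ (t + (1 - 2t²) r)/(1 - t r) equals 1 at t = 1 and is strictly decreasing at t = 1, so it exceeds 1 for some t < 1. -/
/-- **Failure of the Blaschke-factor bound beyond radius `1/3`.** For every
`1/3 < r < 1` there is some `0 < t < 1` with
`(t + (1 - 2t²) r)/(1 - t r) > 1`. -/
theorem blaschke_bound_fails_beyond_third (r : ℝ) (hr13 : 1 / 3 < r) (hr1 : r < 1) :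
    ∃ t : ℝ, 0 < t ∧ t < 1 ∧ 1 < (t + (1 - 2 * t ^ 2) * r) / (1 - t * r) := by
  have hr : 0 < r := by linarith
  have ht1 : (1 + r) / (4 * r) < 1 := by
    rw [div_lt_one (by positivity)]
    linarith
  have hrt : 2 * r * ((1 + r) / (4 * r)) = (1 + r) / 2 := by
    field_simp
    ring
  have ht0 : 0 < (1 + r) / (4 * r) := by positivity
  generalize (1 + r) / (4 * r) = t at ht0 ht1 hrt
  refine ⟨t, ht0, ht1, ?_⟩
  rw [one_lt_div (by nlinarith)]
  have h : 0 < (1 - t) * (2 * r * t + r - 1) :=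
    mul_pos (by linarith) (by linarith)
  linarith
end
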